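/- Fix a joint probability mass function p on S × T. Suppose (m_{ij}(m))_{m≥1} is a sequence of graph samples, where the sample of index m has m edges, such that m_{ij}(m)/m → p(i,j) as m → ∞ for every (i,j) ∈ S × T. Let M_∅ denote the null coclustering model with k_S = k_T = 1 (both cluster maps constant). Then (c_m(M_∅) − min_M c_m(M))/m converges, as m → ∞, to the mutual information I(p) of p, where the minimum is taken over the (finite) set of all coclustering models M = (f_S, f_T). -/

import Mathlib

open Finset Filter

/-- Stirling numbers of the second kind `S(n,k)`. -/
def stirling2 : ℕ → ℕ → ℕ
  | 0, 0 => 1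
  | 0, _ + 1 => 0
  | _ + 1, 0 => 0
  | n + 1, k + 1 => (k + 1) * stirling2 n (k + 1) + stirling2 n k

/-- `B(n,k) = Σ_{i=1}^k S(n,i)`: number of divisions of `n` elements into at most `k` subsets. -/
def bellPartial (n k : ℕ) : ℕ := ∑ i ∈ Finset.Icc 1 k, stirling2 n i

/-- A coclustering model: surjective cluster maps `f_S : S → {1,…,k_S}`,
`f_T : T → {1,…,k_T}` with `1 ≤ k_S`, `1 ≤ k_T`. -/
structure CoclusterModel (S T : Type*) [Fintype S] [Fintype T] where
  kS : ℕ
  kT : ℕ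
  kS_pos : 1 ≤ kS
  kT_pos : 1 ≤ kT
  fS : S → Fin kS
  fT : T → Fin kT
  fS_surj : Function.Surjective fS
  fT_surj : Function.Surjective fT

/-- Cocluster edge counts `m^{ST}_{κλ}` induced by a model on a count matrix `w`. -/
def coCount {S T : Type*} [Fintype S] [Fintype T]
    (M : CoclusterModel S T) (w : S → T → ℕ) (κ : Fin M.kS) (lam : Fin M.kT) : ℕ :=
  ∑ i : S, ∑ j : T, if M.fS i = κ ∧ M.fT j = lam then w i j else 0

/-- The MODL evaluation criterion `c_m(M)` for a coclustering model `M` on a graph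
sample given by the count matrix `w` with `m` edges. -/
noncomputable def cCrit {S T : Type*} [Fintype S] [Fintype T]
    (M : CoclusterModel S T) (w : S → T → ℕ) (m : ℕ) : ℝ :=
  Real.log (Fintype.card S : ℝ) + Real.log (Fintype.card T : ℝ)
  + Real.log (bellPartial (Fintype.card S) M.kS : ℝ)
  + Real.log (bellPartial (Fintype.card T) M.kT : ℝ)
  + Real.log ((m + M.kS * M.kT - 1).choose (M.kS * M.kT - 1) : ℝ)
  + ∑ κ : Fin M.kS,
      Real.log ((((∑ lam : Fin M.kT, coCount M w κ lam)
          + (Finset.univ.filter (fun i : S => M.fS i = κ)).card - 1).choose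
          ((Finset.univ.filter (fun i : S => M.fS i = κ)).card - 1) : ℕ) : ℝ)
  + ∑ lam : Fin M.kT,
      Real.log ((((∑ κ : Fin M.kS, coCount M w κ lam)
          + (Finset.univ.filter (fun j : T => M.fT j = lam)).card - 1).choose
          ((Finset.univ.filter (fun j : T => M.fT j = lam)).card - 1) : ℕ) : ℝ)
  + Real.log (m.factorial : ℝ)
  - ∑ κ : Fin M.kS, ∑ lam : Fin M.kT, Real.log ((coCount M w κ lam).factorial : ℝ)
  + ∑ κ : Fin M.kS, Real.log ((∑ lam : Fin M.kT, coCount M w κ lam).factorial : ℝ)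
  - ∑ i : S, Real.log ((∑ j : T, w i j).factorial : ℝ)
  + ∑ lam : Fin M.kT, Real.log ((∑ κ : Fin M.kS, coCount M w κ lam).factorial : ℝ)
  - ∑ j : T, Real.log ((∑ i : S, w i j).factorial : ℝ)

/-- Shannon entropy `H(p) = −Σ_x p(x) log p(x)` (natural log, `0·log 0 = 0`). -/
noncomputable def shannonEntropy {X : Type*} [Fintype X] (p : X → ℝ) : ℝ :=
  -∑ x : X, p x * Real.log (p x)

/-- Mutual information `I(p) = Σ_{x,y} p(x,y) log(p(x,y)/(p_X(x)·p_Y(y)))`. -/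
noncomputable def mutualInfo {X Y : Type*} [Fintype X] [Fintype Y] (p : X × Y → ℝ) : ℝ :=
  ∑ z : X × Y, p z * Real.log (p z / ((∑ y : Y, p (z.1, y)) * (∑ x : X, p (x, z.2))))

/-- The grouped joint pmf `(f,g)∗p` on `X' × Y'`. -/
def pushJoint {X Y X' Y' : Type*} [Fintype X] [Fintype Y]
    [DecidableEq X'] [DecidableEq Y'] (f : X → X') (g : Y → Y') (p : X × Y → ℝ) :
    X' × Y' → ℝ :=
  fun z => ∑ x : X, ∑ y : Y, if f x = z.1 ∧ g y = z.2 then p (x, y) else 0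


lemma aux_fac_lower (n : ℕ) : (n:ℝ) * Real.log n - n ≤ Real.log (n.factorial : ℝ) := by
  rcases Nat.eq_zero_or_pos n with rfl | hn
  · simp
  have hn' : (0:ℝ) < n := by exact_mod_cast hn
  have hf : (0:ℝ) < n.factorial := by exact_mod_cast n.factorial_pos
  have h := Real.pow_div_factorial_le_exp (n:ℝ) hn'.le n
  have h2 := Real.log_le_log (by positivity) h
  rw [Real.log_exp, Real.log_div (by positivity) (by positivity), Real.log_pow] at h2
  linarith

lemma aux_fac_upper (n : ℕ) :
    Real.log (n.factorial : ℝ) ≤ (n:ℝ) * Real.log n - n + Real.log n + 1 := by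
  rcases Nat.eq_zero_or_pos n with rfl | hn
  · simp
  induction n, hn using Nat.le_induction with
  | base => simp
  | succ n hn ih =>
    have hn' : (0:ℝ) < n := by exact_mod_cast hn
    have hf : (0:ℝ) < n.factorial := by exact_mod_cast n.factorial_pos
    rw [Nat.factorial_succ]
    push_cast
    rw [Real.log_mul (by positivity) (by positivity)]
    have h := Real.log_le_sub_one_of_pos (show (0:ℝ) < n / (n+1) by positivity)
    rw [Real.log_div (by positivity) (by positivity)] at h
    have h3 : ((n:ℝ)+1) * (Real.log n - Real.log (n+1)) ≤ -1 := by
      calc ((n:ℝ)+1) * (Real.log n - Real.log (n+1)) ≤ (n+1) * (n/(n+1) - 1) := by gcongr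
        _ = -1 := by field_simp; ring
    linarith

lemma aux_log_div : Tendsto (fun m : ℕ => Real.log (m:ℝ) / m) atTop (nhds 0) :=
  (Real.isLittleO_log_id_atTop.tendsto_div_nhds_zero).comp tendsto_natCast_atTop_atTop

lemma aux_const_div (c : ℝ) : Tendsto (fun m : ℕ => c / (m:ℝ)) atTop (nhds 0) :=
  tendsto_const_nhds.div_atTop tendsto_natCast_atTop_atTop

lemma aux_fac_lim (a : ℕ → ℕ) (q : ℝ) (ha : ∀ m, 1 ≤ m → a m ≤ m)
    (h : Tendsto (fun m => (a m : ℝ) / m) atTop (nhds q)) :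
    Tendsto (fun m : ℕ => (Real.log ((a m).factorial : ℝ) - a m * (Real.log m - 1)) / m)
      atTop (nhds (q * Real.log q)) := by
  have h1 : Tendsto (fun m : ℕ => ((a m : ℝ) / m) * Real.log ((a m : ℝ) / m)) atTop
      (nhds (q * Real.log q)) := (Real.continuous_mul_log.tendsto q).comp h
  have h2 : Tendsto (fun m : ℕ => ((a m : ℝ) / m) * Real.log ((a m : ℝ) / m)
      + (Real.log (m:ℝ) / m + 1 / (m:ℝ))) atTop (nhds (q * Real.log q)) := by
    simpa using h1.add (aux_log_div.add (aux_const_div 1))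
  have key : ∀ m : ℕ, 1 ≤ m → ((a m : ℝ) / m) * Real.log ((a m : ℝ) / m)
      = (a m * Real.log (a m) - a m * Real.log m) / m := by
    intro m hm
    have hm' : (0:ℝ) < m := by exact_mod_cast hm
    rcases Nat.eq_zero_or_pos (a m) with h0 | h0
    · simp [h0]
    have h0' : (0:ℝ) < a m := by exact_mod_cast h0
    rw [Real.log_div h0'.ne' hm'.ne']
    ring
  refine tendsto_of_tendsto_of_tendsto_of_le_of_le' h1 h2 ?_ ?_
  · filter_upwards [eventually_ge_atTop 1] with m hm
    rw [key m hm]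
    have := aux_fac_lower (a m)
    apply div_le_div_of_nonneg_right _ (Nat.cast_nonneg m)
    linarith
  · filter_upwards [eventually_ge_atTop 1] with m hm
    rw [key m hm, ← add_div, ← add_div]
    have := aux_fac_upper (a m)
    have h3 : Real.log (a m) ≤ Real.log m := by
      rcases Nat.eq_zero_or_pos (a m) with h0 | h0
      · simp [h0, Real.log_natCast_nonneg]
      · exact Real.log_le_log (by exact_mod_cast h0) (by exact_mod_cast ha m hm)
    gcongr
    linarith

lemma aux_choose_lim (a : ℕ → ℕ) (n : ℕ) (ha : ∀ m, 1 ≤ m → a m ≤ m) :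
    Tendsto (fun m : ℕ => Real.log (((a m + n - 1).choose (n - 1) : ℕ) : ℝ) / m)
      atTop (nhds 0) := by
  have h2 : Tendsto (fun m : ℕ => (n:ℝ) * (Real.log (m:ℝ) / m + Real.log (n+1) / (m:ℝ)))
      atTop (nhds 0) := by
    simpa using (aux_log_div.add (aux_const_div (Real.log (n+1)))).const_mul (n:ℝ)
  refine tendsto_of_tendsto_of_tendsto_of_le_of_le' tendsto_const_nhds h2 ?_ ?_
  · exact Eventually.of_forall fun m => div_nonneg (Real.log_natCast_nonneg _) (by positivity)
  · filter_upwards [eventually_ge_atTop 1] with m hm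
    have hm' : (0:ℝ) < m := by exact_mod_cast hm
    rw [← add_div, ← mul_div_assoc]
    gcongr
    have hc : (a m + n - 1).choose (n - 1) ≤ (m * (n+1)) ^ n := by
      calc (a m + n - 1).choose (n - 1) ≤ (a m + n - 1) ^ (n-1) := Nat.choose_le_pow _ _
        _ ≤ (m * (n+1)) ^ (n-1) := by
          gcongr
          have := ha m hm
          have : n ≤ m * n := Nat.le_mul_of_pos_left n hm
          have : m * (n+1) = m * n + m := by ring
          omega
        _ ≤ (m * (n+1)) ^ n := Nat.pow_le_pow_right (by positivity) (by omega)
    have hpos : 0 < (a m + n - 1).choose (n - 1) := Nat.choose_pos (by omega)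
    have := Real.log_le_log (by exact_mod_cast hpos) (Nat.cast_le (α := ℝ).2 hc)
    push_cast at this
    rwa [Real.log_pow, Real.log_mul (by positivity) (by positivity)] at this

instance aux_finite {S T : Type*} [Fintype S] [Fintype T] : Finite (CoclusterModel S T) := by
  classical
  let Φ : CoclusterModel S T → Σ (a : Fin (Fintype.card S + 1)) (b : Fin (Fintype.card T + 1)),
      (S → Fin a) × (T → Fin b) := fun M =>
    ⟨⟨M.kS, by have := Fintype.card_le_of_surjective _ M.fS_surj; simp at this; omega⟩,
     ⟨M.kT, by have := Fintype.card_le_of_surjective _ M.fT_surj; simp at this; omega⟩,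
     (M.fS, M.fT)⟩
  apply Finite.of_injective Φ
  rintro ⟨a, b, _, _, f, g, _, _⟩ ⟨a', b', _, _, f', g', _, _⟩ h
  simp only [Φ, Sigma.mk.injEq, Fin.mk.injEq] at h
  obtain ⟨rfl, h⟩ := h
  simp only [heq_eq_eq, Sigma.mk.injEq, Fin.mk.injEq] at h
  obtain ⟨rfl, h⟩ := h
  simp only [heq_eq_eq, Prod.mk.injEq] at h
  obtain ⟨rfl, rfl⟩ := h
  rfl

lemma aux_iInf {ι : Type*} [Finite ι] [Nonempty ι] (f : ℕ → ι → ℝ) (L : ι → ℝ)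
    (h : ∀ i, Tendsto (fun m => f m i) atTop (nhds (L i))) (i0 : ι) (hi0 : ∀ i, L i0 ≤ L i) :
    Tendsto (fun m => ⨅ i, f m i) atTop (nhds (L i0)) := by
  cases nonempty_fintype ι
  have h1 : L i0 = Finset.univ.inf' Finset.univ_nonempty L := by
    apply le_antisymm
    · exact Finset.le_inf' _ _ (fun i _ => hi0 i)
    · exact Finset.inf'_le _ (Finset.mem_univ _)
  rw [h1]
  have := Filter.Tendsto.finset_inf'_nhds_apply (s := (Finset.univ : Finset ι))
    Finset.univ_nonempty (f := fun i m => f m i) (g := L) (l := atTop) (fun i _ => h i)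
  refine this.congr fun m => ?_
  rw [Finset.inf'_univ_eq_ciInf]

section dpi
variable {S T A B : Type*} [Fintype S] [Fintype T] [Fintype A] [Fintype B]
  [DecidableEq A] [DecidableEq B]

def auxQ (f : S → A) (g : T → B) (P : S → T → ℝ) (a : A) (b : B) : ℝ :=
  ∑ i : S, ∑ j : T, if f i = a ∧ g j = b then P i j else 0

lemma aux_fiber (f : S → A) (u : S → ℝ) (h : A → ℝ) :
    ∑ a, (∑ i, if f i = a then u i else 0) * h a = ∑ i, u i * h (f i) := by
  simp_rw [Finset.sum_mul, ite_mul, zero_mul]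
  rw [Finset.sum_comm]
  simp

lemma auxQ_row (f : S → A) (g : T → B) (P : S → T → ℝ) (a : A) :
    ∑ b, auxQ f g P a b = ∑ i, if f i = a then ∑ j, P i j else 0 := by
  unfold auxQ
  rw [Finset.sum_comm]
  refine Finset.sum_congr rfl fun i _ => ?_
  rw [Finset.sum_comm]
  by_cases h : f i = a <;> simp [h]

lemma auxQ_col (f : S → A) (g : T → B) (P : S → T → ℝ) (b : B) :
    ∑ a, auxQ f g P a b = ∑ j, if g j = b then ∑ i, P i j else 0 := by
  unfold auxQ
  rw [Finset.sum_comm]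
  calc ∑ i, ∑ a, ∑ j, (if f i = a ∧ g j = b then P i j else 0)
      = ∑ i, ∑ j, (if g j = b then P i j else 0) := by
        refine Finset.sum_congr rfl fun i _ => ?_
        rw [Finset.sum_comm]
        refine Finset.sum_congr rfl fun j _ => ?_
        by_cases h : g j = b <;> simp [h]
    _ = _ := by
        rw [Finset.sum_comm]
        refine Finset.sum_congr rfl fun j _ => ?_
        by_cases h : g j = b <;> simp [h]

lemma auxQ_sum (f : S → A) (g : T → B) (P : S → T → ℝ) (h : A → B → ℝ) :
    ∑ a, ∑ b, auxQ f g P a b * h a b = ∑ i, ∑ j, P i j * h (f i) (g j) := by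
  have e : ∀ a b, auxQ f g P a b * h a b
      = ∑ i, ∑ j, if f i = a then (if g j = b then P i j * h a b else 0) else 0 := by
    intro a b
    unfold auxQ
    simp_rw [Finset.sum_mul, ite_mul, zero_mul, ite_and]
  simp_rw [e]
  calc _ = ∑ a, ∑ i, ∑ j, ∑ b,
        (if f i = a then (if g j = b then P i j * h a b else 0) else 0) := by
        refine Finset.sum_congr rfl fun a _ => ?_
        rw [Finset.sum_comm]
        refine Finset.sum_congr rfl fun i _ => ?_
        rw [Finset.sum_comm]
    _ = ∑ i, ∑ j, ∑ a, ∑ b,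
        (if f i = a then (if g j = b then P i j * h a b else 0) else 0) := by
        rw [Finset.sum_comm]
        refine Finset.sum_congr rfl fun i _ => ?_
        rw [Finset.sum_comm]
    _ = _ := by
        refine Finset.sum_congr rfl fun i _ => Finset.sum_congr rfl fun j _ => ?_
        rw [Finset.sum_eq_single (f i), Finset.sum_eq_single (g j)] <;> simp +contextual [eq_comm]

noncomputable def auxD (f : S → A) (g : T → B) (P : S → T → ℝ) : ℝ :=
  (∑ a, ∑ b, auxQ f g P a b * Real.log (auxQ f g P a b))
  - (∑ a, (∑ b, auxQ f g P a b) * Real.log (∑ b, auxQ f g P a b))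
  - (∑ b, (∑ a, auxQ f g P a b) * Real.log (∑ a, auxQ f g P a b))

lemma auxD_eq (f : S → A) (g : T → B) (P : S → T → ℝ) :
    auxD f g P = ∑ i, ∑ j, P i j * (Real.log (auxQ f g P (f i) (g j))
      - Real.log (∑ b, auxQ f g P (f i) b) - Real.log (∑ a, auxQ f g P a (g j))) := by
  rw [← auxQ_sum f g P (fun a b => Real.log (auxQ f g P a b)
      - Real.log (∑ b, auxQ f g P a b) - Real.log (∑ a, auxQ f g P a b))]
  simp_rw [mul_sub, Finset.sum_sub_distrib]
  unfold auxD
  congr 1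
  · congr 1
    simp_rw [Finset.sum_mul]
  · rw [Finset.sum_comm (f := fun a b => auxQ f g P a b * Real.log (∑ a, auxQ f g P a b))]
    simp_rw [Finset.sum_mul]

lemma aux_mi (p : S × T → ℝ) (hp0 : ∀ z, 0 ≤ p z) :
    mutualInfo p = ∑ i, ∑ j, p (i, j) * (Real.log (p (i, j))
      - Real.log (∑ j, p (i, j)) - Real.log (∑ i, p (i, j))) := by
  unfold mutualInfo
  rw [Fintype.sum_prod_type]
  refine Finset.sum_congr rfl fun i _ => Finset.sum_congr rfl fun j _ => ?_
  rcases (hp0 (i,j)).eq_or_lt with h | h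
  · simp [← h]
  have h1 : 0 < ∑ y, p (i, y) :=
    h.trans_le (Finset.single_le_sum (f := fun y => p (i,y)) (fun y _ => hp0 _) (Finset.mem_univ j))
  have h2 : 0 < ∑ x, p (x, j) :=
    h.trans_le (Finset.single_le_sum (f := fun x => p (x,j)) (fun y _ => hp0 _) (Finset.mem_univ i))
  simp only
  rw [Real.log_div h.ne' (by positivity), Real.log_mul h1.ne' h2.ne']
  ring

lemma auxD_inj (f : S → A) (g : T → B) (hf : f.Injective) (hg : g.Injective)
    (p : S × T → ℝ) (hp0 : ∀ z, 0 ≤ p z) :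
    auxD f g (fun i j => p (i, j)) = mutualInfo p := by
  classical
  rw [auxD_eq, aux_mi p hp0]
  refine Finset.sum_congr rfl fun i _ => Finset.sum_congr rfl fun j _ => ?_
  rw [auxQ_row, auxQ_col]
  unfold auxQ
  simp [hf.eq_iff, hg.eq_iff, ite_and]

lemma auxD_le (f : S → A) (g : T → B) (p : S × T → ℝ) (hp0 : ∀ z, 0 ≤ p z) :
    auxD f g (fun i j => p (i, j)) ≤ mutualInfo p := by
  rw [auxD_eq, aux_mi p hp0]
  set q := auxQ f g (fun i j => p (i, j)) with hq
  set r : A → ℝ := fun a => ∑ b, q a b with hr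
  set c : B → ℝ := fun b => ∑ a, q a b with hc
  have hq0 : ∀ a b, 0 ≤ q a b := fun a b => Finset.sum_nonneg fun i _ =>
    Finset.sum_nonneg fun j _ => by split_ifs <;> simp [hp0]
  have hr0 : ∀ a, 0 ≤ r a := fun a => Finset.sum_nonneg fun b _ => hq0 a b
  have hc0 : ∀ b, 0 ≤ c b := fun b => Finset.sum_nonneg fun a _ => hq0 a b
  have hs0 : ∀ i, 0 ≤ ∑ j, p (i, j) := fun i => Finset.sum_nonneg fun j _ => hp0 _
  have ht0 : ∀ j, 0 ≤ ∑ i, p (i, j) := fun i => Finset.sum_nonneg fun j _ => hp0 _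
  have hpq : ∀ i j, p (i, j) ≤ q (f i) (g j) := by
    intro i j
    have hn : ∀ i' j', 0 ≤ if f i' = f i ∧ g j' = g j then p (i', j') else 0 := by
      intro i' j'; split_ifs <;> simp [hp0]
    calc p (i, j) = if f i = f i ∧ g j = g j then p (i, j) else 0 := by simp
      _ ≤ ∑ j', if f i = f i ∧ g j' = g j then p (i, j') else 0 :=
        Finset.single_le_sum (f := fun j' => if f i = f i ∧ g j' = g j then p (i, j') else 0)
          (fun j' _ => hn i j') (Finset.mem_univ j)
      _ ≤ _ := Finset.single_le_sum
          (f := fun i' => ∑ j', if f i' = f i ∧ g j' = g j then p (i', j') else 0)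
          (fun i' _ => Finset.sum_nonneg fun j' _ => hn i' j') (Finset.mem_univ i)
  have key : ∀ i j, p (i,j) - (∑ j, p (i, j)) * ((∑ i, p (i, j)) *
        (q (f i) (g j) / (r (f i) * c (g j))))
      ≤ p (i, j) * (Real.log (p (i, j))
      - Real.log (∑ j, p (i, j)) - Real.log (∑ i, p (i, j)))
      - p (i, j) * (Real.log (q (f i) (g j)) - Real.log (r (f i)) - Real.log (c (g j))) := by
    intro i j
    rcases (hp0 (i,j)).eq_or_lt with h | h
    · rw [← h]
      have : 0 ≤ (∑ j, p (i, j)) * ((∑ i, p (i, j)) * (q (f i) (g j) / (r (f i) * c (g j)))) :=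
        mul_nonneg (hs0 i) (mul_nonneg (ht0 j)
          (div_nonneg (hq0 _ _) (mul_nonneg (hr0 _) (hc0 _))))
      linarith
    have h1 : 0 < ∑ y, p (i, y) :=
      h.trans_le (Finset.single_le_sum (f := fun y => p (i,y)) (fun y _ => hp0 _)
        (Finset.mem_univ j))
    have h2 : 0 < ∑ x, p (x, j) :=
      h.trans_le (Finset.single_le_sum (f := fun x => p (x,j)) (fun y _ => hp0 _)
        (Finset.mem_univ i))
    have h3 : 0 < q (f i) (g j) := h.trans_le (hpq i j)
    have h4 : 0 < r (f i) := h3.trans_le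
      (Finset.single_le_sum (f := fun b => q (f i) b) (fun b _ => hq0 _ _) (Finset.mem_univ (g j)))
    have h5 : 0 < c (g j) := h3.trans_le
      (Finset.single_le_sum (f := fun a => q a (g j)) (fun b _ => hq0 _ _) (Finset.mem_univ (f i)))
    generalize (∑ y, p (i, y)) = s at *
    generalize (∑ x, p (x, j)) = t at *
    generalize p (i, j) = x at *
    generalize q (f i) (g j) = y at *
    generalize r (f i) = u at *
    generalize c (g j) = v at *
    have hl := Real.one_sub_inv_le_log_of_pos
      (show 0 < (x * (u * v)) / ((s * t) * y) by positivity)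
    rw [Real.log_div (by positivity) (by positivity), Real.log_mul (by positivity) (by positivity),
      Real.log_mul (by positivity) (by positivity), Real.log_mul (by positivity) (by positivity),
      Real.log_mul (by positivity) (by positivity)] at hl
    have hl2 := mul_le_mul_of_nonneg_left hl h.le
    have e : x * (1 - ((x * (u * v)) / ((s * t) * y))⁻¹) = x - s * (t * (y / (u * v))) := by
      field_simp
    rw [e] at hl2
    linarith
  have tot : ∑ i, ∑ j, (∑ j, p (i, j)) * ((∑ i, p (i, j)) *
        (q (f i) (g j) / (r (f i) * c (g j)))) ≤ ∑ i, ∑ j, p (i, j) := by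
    calc _ = ∑ a, ∑ b, r a * (c b * (q a b / (r a * c b))) := by
          have e1 : ∀ a, r a = ∑ i, if f i = a then ∑ j, p (i,j) else 0 := fun a =>
            auxQ_row f g (fun i j => p (i, j)) a
          have e2 : ∀ b, c b = ∑ j, if g j = b then ∑ i, p (i,j) else 0 := fun b =>
            auxQ_col f g (fun i j => p (i, j)) b
          symm
          calc ∑ a, ∑ b, r a * (c b * (q a b / (r a * c b)))
              = ∑ a, (∑ i, if f i = a then ∑ j, p (i,j) else 0) *
                  ∑ b, (∑ j, if g j = b then ∑ i, p (i,j) else 0) * (q a b / (r a * c b)) := by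
                refine Finset.sum_congr rfl fun a _ => ?_
                rw [← e1, Finset.mul_sum]
                refine Finset.sum_congr rfl fun b _ => ?_
                rw [← e2]
            _ = _ := by
                rw [aux_fiber f (fun i => ∑ j, p (i,j)) (fun a =>
                  ∑ b, (∑ j, if g j = b then ∑ i, p (i,j) else 0) * (q a b / (r a * c b)))]
                refine Finset.sum_congr rfl fun i _ => ?_
                rw [aux_fiber g (fun j => ∑ i, p (i,j)) (fun b => q (f i) b / (r (f i) * c b)),
                  Finset.mul_sum]
      _ ≤ ∑ a, ∑ b, q a b * 1 := by
          refine Finset.sum_le_sum fun a _ => Finset.sum_le_sum fun b _ => ?_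
          rcases (hr0 a).eq_or_lt with h | h
          · rw [← h]; simp [hq0]
          rcases (hc0 b).eq_or_lt with h' | h'
          · rw [← h']; simp [hq0]
          apply le_of_eq
          field_simp
      _ = _ := by rw [auxQ_sum f g _ (fun _ _ => 1)]; simp
  have := Finset.sum_le_sum fun i (_ : i ∈ (Finset.univ : Finset S)) =>
    Finset.sum_le_sum fun j (_ : j ∈ (Finset.univ : Finset T)) => key i j
  simp only [Finset.sum_sub_distrib] at this
  linarith

end dpi

lemma aux_coCount {S T : Type*} [Fintype S] [Fintype T] (M : CoclusterModel S T)
    (w : S → T → ℕ) (κ : Fin M.kS) (lam : Fin M.kT) :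
    (coCount M w κ lam : ℝ) = auxQ M.fS M.fT (fun i j => (w i j : ℝ)) κ lam := by
  unfold coCount auxQ
  push_cast
  rfl

lemma aux_coCount_tot {S T : Type*} [Fintype S] [Fintype T] (M : CoclusterModel S T)
    (w : S → T → ℕ) :
    ∑ κ, ∑ lam, coCount M w κ lam = ∑ i, ∑ j, w i j := by
  have h := auxQ_sum M.fS M.fT (fun i j => (w i j : ℝ)) (fun _ _ => 1)
  simp only [mul_one, ← aux_coCount] at h
  exact_mod_cast h

lemma aux_crit_lim {S T : Type*} [Fintype S] [Fintype T]
    (p : S × T → ℝ) (hp1 : ∑ z : S × T, p z = 1)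
    (w : ℕ → S → T → ℕ)
    (hw : ∀ m : ℕ, 1 ≤ m → (∑ i : S, ∑ j : T, w m i j) = m)
    (hconv : ∀ i j, Tendsto (fun m : ℕ => (w m i j : ℝ) / m) atTop (nhds (p (i, j))))
    (M : CoclusterModel S T) :
    Tendsto (fun m : ℕ => cCrit M (w m) m / m) atTop
      (nhds (-(∑ i, (∑ j, p (i, j)) * Real.log (∑ j, p (i, j)))
      - (∑ j, (∑ i, p (i, j)) * Real.log (∑ i, p (i, j)))
      - auxD M.fS M.fT (fun i j => p (i, j)))) := by
  classical
  have tot : ∀ m, 1 ≤ m → ∑ κ, ∑ lam, coCount M (w m) κ lam = m := fun m hm => by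
    rw [aux_coCount_tot, hw m hm]
  have tot' : ∀ m, 1 ≤ m → ∑ lam, ∑ κ, coCount M (w m) κ lam = m := fun m hm => by
    rw [Finset.sum_comm, tot m hm]
  have hw' : ∀ m : ℕ, 1 ≤ m → (∑ j : T, ∑ i : S, w m i j) = m := fun m hm => by
    rw [Finset.sum_comm, hw m hm]
  -- bounds
  have bR : ∀ κ m, 1 ≤ m → ∑ lam, coCount M (w m) κ lam ≤ m := fun κ m hm => by
    calc _ ≤ ∑ κ, ∑ lam, coCount M (w m) κ lam :=
          Finset.single_le_sum (f := fun κ => ∑ lam, coCount M (w m) κ lam)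
            (fun _ _ => Nat.zero_le _) (Finset.mem_univ κ)
      _ = m := tot m hm
  have bC : ∀ lam m, 1 ≤ m → ∑ κ, coCount M (w m) κ lam ≤ m := fun lam m hm => by
    calc _ ≤ ∑ lam, ∑ κ, coCount M (w m) κ lam :=
          Finset.single_le_sum (f := fun lam => ∑ κ, coCount M (w m) κ lam)
            (fun _ _ => Nat.zero_le _) (Finset.mem_univ lam)
      _ = m := tot' m hm
  have bQ : ∀ κ lam m, 1 ≤ m → coCount M (w m) κ lam ≤ m := fun κ lam m hm =>
    (Finset.single_le_sum (f := fun lam => coCount M (w m) κ lam)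
            (fun _ _ => Nat.zero_le _) (Finset.mem_univ lam)).trans (bR κ m hm)
  have bS : ∀ i m, 1 ≤ m → ∑ j, w m i j ≤ m := fun i m hm => by
    calc _ ≤ ∑ i, ∑ j, w m i j :=
          Finset.single_le_sum (f := fun i => ∑ j, w m i j)
            (fun _ _ => Nat.zero_le _) (Finset.mem_univ i)
      _ = m := hw m hm
  have bT : ∀ j m, 1 ≤ m → ∑ i, w m i j ≤ m := fun j m hm => by
    calc _ ≤ ∑ j, ∑ i, w m i j :=
          Finset.single_le_sum (f := fun j => ∑ i, w m i j)
            (fun _ _ => Nat.zero_le _) (Finset.mem_univ j)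
      _ = m := hw' m hm
  -- frequency limits
  have lQ : ∀ κ lam, Tendsto (fun m : ℕ => (coCount M (w m) κ lam : ℝ) / m) atTop
      (nhds (auxQ M.fS M.fT (fun i j => p (i, j)) κ lam)) := by
    intro κ lam
    simp_rw [aux_coCount]
    unfold auxQ
    simp_rw [Finset.sum_div]
    refine tendsto_finset_sum _ fun i _ => tendsto_finset_sum _ fun j _ => ?_
    split_ifs
    · exact hconv i j
    · simp
  have lR : ∀ κ, Tendsto (fun m : ℕ => ((∑ lam, coCount M (w m) κ lam : ℕ) : ℝ) / m) atTop
      (nhds (∑ lam, auxQ M.fS M.fT (fun i j => p (i, j)) κ lam)) := by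
    intro κ
    push_cast
    simp_rw [Finset.sum_div]
    exact tendsto_finset_sum _ fun lam _ => lQ κ lam
  have lC : ∀ lam, Tendsto (fun m : ℕ => ((∑ κ, coCount M (w m) κ lam : ℕ) : ℝ) / m) atTop
      (nhds (∑ κ, auxQ M.fS M.fT (fun i j => p (i, j)) κ lam)) := by
    intro lam
    push_cast
    simp_rw [Finset.sum_div]
    exact tendsto_finset_sum _ fun κ _ => lQ κ lam
  have lS : ∀ i, Tendsto (fun m : ℕ => ((∑ j, w m i j : ℕ) : ℝ) / m) atTop
      (nhds (∑ j, p (i, j))) := by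
    intro i
    push_cast
    simp_rw [Finset.sum_div]
    exact tendsto_finset_sum _ fun j _ => hconv i j
  have lT : ∀ j, Tendsto (fun m : ℕ => ((∑ i, w m i j : ℕ) : ℝ) / m) atTop
      (nhds (∑ i, p (i, j))) := by
    intro j
    push_cast
    simp_rw [Finset.sum_div]
    exact tendsto_finset_sum _ fun i _ => hconv i j
  have l1 : Tendsto (fun m : ℕ => (m : ℝ) / m) atTop (nhds 1) := by
    refine tendsto_const_nhds.congr' ?_
    filter_upwards [eventually_ge_atTop 1] with m hm
    have hm' : (0:ℝ) < m := by exact_mod_cast hm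
    field_simp
  -- all the pieces
  have t0 := aux_const_div (Real.log (Fintype.card S : ℝ) + Real.log (Fintype.card T : ℝ)
    + Real.log (bellPartial (Fintype.card S) M.kS : ℝ)
    + Real.log (bellPartial (Fintype.card T) M.kT : ℝ))
  have t1 := aux_choose_lim (fun m => m) (M.kS * M.kT) (fun m _ => le_rfl)
  have t2 := tendsto_finset_sum (Finset.univ : Finset (Fin M.kS)) fun κ _ =>
    aux_choose_lim (fun m => ∑ lam, coCount M (w m) κ lam)
      (Finset.univ.filter (fun i : S => M.fS i = κ)).card (bR κ)
  have t3 := tendsto_finset_sum (Finset.univ : Finset (Fin M.kT)) fun lam _ =>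
    aux_choose_lim (fun m => ∑ κ, coCount M (w m) κ lam)
      (Finset.univ.filter (fun j : T => M.fT j = lam)).card (bC lam)
  have t4 := aux_fac_lim (fun m => m) 1 (fun m _ => le_rfl) l1
  have t5 := tendsto_finset_sum (Finset.univ : Finset (Fin M.kS)) fun κ _ =>
    tendsto_finset_sum (Finset.univ : Finset (Fin M.kT)) fun lam _ =>
      aux_fac_lim _ _ (bQ κ lam) (lQ κ lam)
  have t6 := tendsto_finset_sum (Finset.univ : Finset (Fin M.kS)) fun κ _ =>
      aux_fac_lim _ _ (bR κ) (lR κ)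
  have t7 := tendsto_finset_sum (Finset.univ : Finset S) fun i _ =>
      aux_fac_lim _ _ (bS i) (lS i)
  have t8 := tendsto_finset_sum (Finset.univ : Finset (Fin M.kT)) fun lam _ =>
      aux_fac_lim _ _ (bC lam) (lC lam)
  have t9 := tendsto_finset_sum (Finset.univ : Finset T) fun j _ =>
      aux_fac_lim _ _ (bT j) (lT j)
  have tt := ((((((((t0.add t1).add t2).add t3).add t4).sub t5).add t6).sub t7).add t8).sub t9
  have e : ∀ x y : ℝ, x = y → nhds x = nhds y := fun x y h => by rw [h]
  refine (tt.congr' ?_).trans (le_of_eq (e _ _ ?_))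
  · filter_upwards [eventually_ge_atTop 1] with m hm
    simp only [← Finset.sum_div, Finset.sum_sub_distrib, ← Finset.sum_mul, ← Nat.cast_sum,
      tot m hm, tot' m hm, hw m hm, hw' m hm]
    unfold cCrit
    ring
  · unfold auxD
    simp only [Finset.sum_const_zero, Real.log_one]
    ring

/-- if the empirical edge frequencies of a sequence of graph samples
converge to a joint pmf `p`, then `(c_m(M_∅) − min_M c_m(M))/m → I(p)`, where `M_∅`
is the null model with `k_S = k_T = 1`. -/
theorem modl_mutual_information_limit
    {S T : Type*} [Fintype S] [Fintype T]
    (hS : 1 ≤ Fintype.card S) (hT : 1 ≤ Fintype.card T)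
    (p : S × T → ℝ) (hp0 : ∀ z, 0 ≤ p z) (hp1 : ∑ z : S × T, p z = 1)
    (w : ℕ → S → T → ℕ)
    (hw : ∀ m : ℕ, 1 ≤ m → (∑ i : S, ∑ j : T, w m i j) = m)
    (hconv : ∀ i j, Tendsto (fun m : ℕ => (w m i j : ℝ) / m) atTop (nhds (p (i, j))))
    (M0 : CoclusterModel S T) (hM0S : M0.kS = 1) (hM0T : M0.kT = 1) :
    Tendsto
      (fun m : ℕ => (cCrit M0 (w m) m - ⨅ M : CoclusterModel S T, cCrit M (w m) m) / m)
      atTop (nhds (mutualInfo p)) := by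
  classical
  have hSne : Nonempty S := Fintype.card_pos_iff.1 hS
  have hTne : Nonempty T := Fintype.card_pos_iff.1 hT
  set K : ℝ := -(∑ i, (∑ j, p (i, j)) * Real.log (∑ j, p (i, j)))
      - (∑ j, (∑ i, p (i, j)) * Real.log (∑ i, p (i, j))) with hK
  have hlim := aux_crit_lim p hp1 w hw hconv
  let M1 : CoclusterModel S T :=
    { kS := Fintype.card S, kT := Fintype.card T, kS_pos := hS, kT_pos := hT
      fS := Fintype.equivFin S, fT := Fintype.equivFin T
      fS_surj := (Fintype.equivFin S).surjective
      fT_surj := (Fintype.equivFin T).surjective }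
  haveI : Nonempty (CoclusterModel S T) := ⟨M1⟩
  have hD1 : auxD M1.fS M1.fT (fun i j => p (i, j)) = mutualInfo p :=
    auxD_inj _ _ (Fintype.equivFin S).injective (Fintype.equivFin T).injective p hp0
  have hD0 : auxD M0.fS M0.fT (fun i j => p (i, j)) = 0 := by
    haveI : Subsingleton (Fin M0.kS) := by rw [hM0S]; infer_instance
    haveI : Subsingleton (Fin M0.kT) := by rw [hM0T]; infer_instance
    have hp1' : ∑ i, ∑ j, p (i, j) = 1 := by rw [← hp1, Fintype.sum_prod_type]
    have hp1'' : ∑ j, ∑ i, p (i, j) = 1 := by rw [← hp1', Finset.sum_comm]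
    rw [auxD_eq]
    refine Finset.sum_eq_zero fun i _ => Finset.sum_eq_zero fun j _ => ?_
    rw [auxQ_row, auxQ_col]
    have e1 : ∀ i' : S, M0.fS i' = M0.fS i := fun _ => Subsingleton.elim _ _
    have e2 : ∀ j' : T, M0.fT j' = M0.fT j := fun _ => Subsingleton.elim _ _
    simp [auxQ, e1, e2, hp1', hp1'']
  have hinf := aux_iInf (fun (m : ℕ) (M : CoclusterModel S T) => cCrit M (w m) m / m)
    (fun M => K - auxD M.fS M.fT (fun i j => p (i, j))) hlim M1 (by
      intro M
      have := auxD_le M.fS M.fT p hp0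
      simp only [hD1]
      linarith)
  have := (hlim M0).sub hinf
  simp only [hD0, hD1] at this
  have e : K - 0 - (K - mutualInfo p) = mutualInfo p := by ring
  rw [e] at this
  refine this.congr fun m => ?_
  rw [sub_div]
  congr 1
  simp_rw [div_eq_mul_inv]
  rw [Real.iInf_mul_of_nonneg (by positivity)]
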